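/- In the Dedukti theory (Σ_EPTS, 𝓡_EPTS): if M is a Dedukti term in β-normal form and ⟦Γ⟧ ⊢ M : Πx:A.B, then M is an abstraction M = λx:A'.N with A' ≡ A and ⟦Γ⟧, x:A ⊢ N : B. -/

import Mathlib

namespace DKPaper

inductive Tm (C : Type) : Type
  | var : Nat → Tm C
  | const : C → List (Tm C) → Tm C
  | type : Tm C
  | kind : Tm C
  | app : Tm C → Tm C → Tm C
  | lam : Tm C → Tm C → Tm C
  | pi : Tm C → Tm C → Tm C

namespace Tm
variable {C : Type}

def liftRen (ρ : Nat → Nat) : Nat → Nat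
  | 0 => 0
  | n + 1 => ρ n + 1

def ren (ρ : Nat → Nat) : Tm C → Tm C
  | var n => var (ρ n)
  | const c Ms => const c (Ms.attach.map fun x => ren ρ x.1)
  | type => type
  | kind => kind
  | app M N => app (ren ρ M) (ren ρ N)
  | lam A M => lam (ren ρ A) (ren (liftRen ρ) M)
  | pi A B => pi (ren ρ A) (ren (liftRen ρ) B)
termination_by t => sizeOf t
decreasing_by
  all_goals simp_wf
  all_goals try omega
  all_goals (have h := List.sizeOf_lt_of_mem x.2; omega)

def liftSub (σ : Nat → Tm C) : Nat → Tm C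
  | 0 => var 0
  | n + 1 => ren Nat.succ (σ n)

def sub (σ : Nat → Tm C) : Tm C → Tm C
  | var n => σ n
  | const c Ms => const c (Ms.attach.map fun x => sub σ x.1)
  | type => type
  | kind => kind
  | app M N => app (sub σ M) (sub σ N)
  | lam A M => lam (sub σ A) (sub (liftSub σ) M)
  | pi A B => pi (sub σ A) (sub (liftSub σ) B)
termination_by t => sizeOf t
decreasing_by
  all_goals simp_wf
  all_goals try omega
  all_goals (have h := List.sizeOf_lt_of_mem x.2; omega)

/-- Substitution of `N` for the variable of de Bruijn index `k` (the usual `M{N/x}`). -/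
def substAt (k : Nat) (N : Tm C) : Tm C → Tm C :=
  sub fun n => if n < k then var n else if n = k then ren (· + k) N else var (n - 1)

end Tm

/-! ## Signatures, rewrite rules, rewriting -/

/-- An entry `c[Δ] : A` of a signature: head constant, telescope (in declaration
order, each entry a type under the previous ones), and the type. -/
abbrev Sig (C : Type) := Set (C × List (Tm C) × Tm C)

/-- A rewrite rule `c[l⃗] ↪ r`: head constant, list of left-hand side argument
patterns (free de Bruijn variables are the pattern variables), right-hand side. -/
abbrev Rules (C : Type) := Set (C × List (Tm C) × Tm C)

variable {C : Type}

/-- Closure of a root relation under all term-forming contexts. -/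
inductive Cong (r : Tm C → Tm C → Prop) : Tm C → Tm C → Prop
  | base {M N} : r M N → Cong r M N
  | appL {M M' N} : Cong r M M' → Cong r (.app M N) (.app M' N)
  | appR {M N N'} : Cong r N N' → Cong r (.app M N) (.app M N')
  | lamA {A A' M} : Cong r A A' → Cong r (.lam A M) (.lam A' M)
  | lamM {A M M'} : Cong r M M' → Cong r (.lam A M) (.lam A M')
  | piA {A A' B} : Cong r A A' → Cong r (.pi A B) (.pi A' B)
  | piB {A B B'} : Cong r B B' → Cong r (.pi A B) (.pi A B')
  | constArg {c l₁ M M' l₂} : Cong r M M' →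
      Cong r (.const c (l₁ ++ M :: l₂)) (.const c (l₁ ++ M' :: l₂))

/-- Root β-reduction. -/
def BetaRoot : Tm C → Tm C → Prop := fun M N =>
  ∃ A P Q, M = .app (.lam A P) Q ∧ N = Tm.substAt 0 Q P

/-- Root reduction by a rule of `R`: a substitution instance of some rule. -/
def RuleRoot (R : Rules C) : Tm C → Tm C → Prop := fun M N =>
  ∃ rl ∈ R, ∃ σ : Nat → Tm C,
    M = Tm.sub σ (.const rl.1 rl.2.1) ∧ N = Tm.sub σ rl.2.2

/-- One-step β-reduction `↪_β`. -/
def Beta : Tm C → Tm C → Prop := Cong BetaRoot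

/-- One-step reduction by the rules of `R` only (no β). -/
def RStep (R : Rules C) : Tm C → Tm C → Prop := Cong (RuleRoot R)

/-- One-step reduction `↪_{β𝓡}`. -/
def Step (R : Rules C) : Tm C → Tm C → Prop :=
  Cong (fun M N => BetaRoot M N ∨ RuleRoot R M N)

/-- The conversion `≡_{β𝓡}` generated by `↪_{β𝓡}`. -/
def Conv (R : Rules C) : Tm C → Tm C → Prop := Relation.EqvGen (Step R)

/-- Confluence of an abstract reduction relation. -/
def Confluent {α : Type _} (r : α → α → Prop) : Prop :=
  ∀ a b c, Relation.ReflTransGen r a b → Relation.ReflTransGen r a c →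
    ∃ d, Relation.ReflTransGen r b d ∧ Relation.ReflTransGen r c d

/-- `M` is in β-normal form. -/
def BetaNormal (M : Tm C) : Prop := ∀ N, ¬ Beta M N

/-- Strong normalization of a relation at a point: no infinite `r`-sequence starts at `a`. -/
def SN {α : Type _} (r : α → α → Prop) (a : α) : Prop := Acc (fun x y => r y x) a


/-! ## Dedukti typing -/

/-- `IsDKSort s` means `s` is `TYPE` or `KIND`. -/
def IsDKSort (s : Tm C) : Prop := s = Tm.type ∨ s = Tm.kind

/-- `A{M⃗}`: simultaneous instantiation of the telescope variables by the arguments. -/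
def instArgs (Ms : List (Tm C)) (A : Tm C) : Tm C :=
  Tm.sub (fun n => Ms.reverse.getD n (Tm.var (n - Ms.length))) A

/-- Instantiate the first variable of the (remaining) telescope `Δ` with `M`. -/
def instTele (M : Tm C) (Δ : List (Tm C)) : List (Tm C) :=
  Δ.mapIdx fun i B => Tm.substAt i M B

mutual
/-- Well-formed contexts `Σ;Γ well-formed` (de Bruijn: last declaration first). -/
inductive Wf (S : Sig C) (R : Rules C) : List (Tm C) → Prop
  | empty : Wf S R []
  | decl {Γ A} : Typed S R Γ A Tm.type → Wf S R (A :: Γ)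

/-- The Dedukti typing judgment `Σ;Γ ⊢ M : A`. -/
inductive Typed (S : Sig C) (R : Rules C) : List (Tm C) → Tm C → Tm C → Prop
  | sort {Γ} : Wf S R Γ → Typed S R Γ Tm.type Tm.kind
  | var {Γ n A} : Wf S R Γ → Γ[n]? = some A →
      Typed S R Γ (Tm.var n) (Tm.ren (· + (n + 1)) A)
  | cons {Γ c Δ A s Ms} : (c, Δ, A) ∈ S → Typed S R Δ.reverse A s → IsDKSort s →
      TypedArgs S R Γ Ms Δ → Typed S R Γ (Tm.const c Ms) (instArgs Ms A)
  | conv {Γ M A B s} : Typed S R Γ M A → Typed S R Γ B s → IsDKSort s →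
      Conv R A B → Typed S R Γ M B
  | prod {Γ A B s} : Typed S R Γ A Tm.type → Typed S R (A :: Γ) B s → IsDKSort s →
      Typed S R Γ (Tm.pi A B) s
  | abs {Γ A B s M} : Typed S R Γ A Tm.type → Typed S R (A :: Γ) B s → IsDKSort s →
      Typed S R (A :: Γ) M B → Typed S R Γ (Tm.lam A M) (Tm.pi A B)
  | app {Γ M N A B} : Typed S R Γ M (Tm.pi A B) → Typed S R Γ N A →
      Typed S R Γ (Tm.app M N) (Tm.substAt 0 N B)

/-- `Σ;Γ ⊢ M⃗ : Δ`: the arguments fit the telescope. -/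
inductive TypedArgs (S : Sig C) (R : Rules C) : List (Tm C) → List (Tm C) → List (Tm C) → Prop
  | nil {Γ} : TypedArgs S R Γ [] []
  | cons {Γ M Ms A Δ} : Typed S R Γ M A → TypedArgs S R Γ Ms (instTele M Δ) →
      TypedArgs S R Γ (M :: Ms) (A :: Δ)
end

/-! ## Type-level and object-level constants, syntactic classes -/

/-- Types of the form `Πx⃗:B⃗.TYPE`. -/
inductive IsKindShape : Tm C → Prop
  | type : IsKindShape Tm.type
  | pi {A K} : IsKindShape K → IsKindShape (Tm.pi A K)

/-- `c` is a type-level constant of the signature `S`. -/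
def TypeLevel (S : Sig C) (c : C) : Prop := ∃ Δ A, (c, Δ, A) ∈ S ∧ IsKindShape A

/-- `c` is an object-level constant of the signature `S`: it is declared, and not type-level. -/
def ObjLevel (S : Sig C) (c : C) : Prop := (∃ Δ A, (c, Δ, A) ∈ S) ∧ ¬ TypeLevel S c

mutual
/-- Kinds: `K ::= TYPE | Πx:T.K`. -/
inductive IsKind (S : Sig C) : Tm C → Prop
  | type : IsKind S Tm.type
  | pi {T K} : IsTypeFam S T → IsKind S K → IsKind S (Tm.pi T K)

/-- Type families: `T ::= α[O⃗] | T O | λx:T.T | Πx:T.T` with `α` type-level. -/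
inductive IsTypeFam (S : Sig C) : Tm C → Prop
  | const {c Os} : TypeLevel S c → (∀ O ∈ Os, IsObj S O) → IsTypeFam S (Tm.const c Os)
  | app {T O} : IsTypeFam S T → IsObj S O → IsTypeFam S (Tm.app T O)
  | lam {T₁ T₂} : IsTypeFam S T₁ → IsTypeFam S T₂ → IsTypeFam S (Tm.lam T₁ T₂)
  | pi {T₁ T₂} : IsTypeFam S T₁ → IsTypeFam S T₂ → IsTypeFam S (Tm.pi T₁ T₂)

/-- Objects: `O ::= x | a[O⃗] | O O | λx:T.O` with `a` object-level. -/
inductive IsObj (S : Sig C) : Tm C → Prop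
  | var {n} : IsObj S (Tm.var n)
  | const {c Os} : ObjLevel S c → (∀ O ∈ Os, IsObj S O) → IsObj S (Tm.const c Os)
  | app {O₁ O₂} : IsObj S O₁ → IsObj S O₂ → IsObj S (Tm.app O₁ O₂)
  | lam {T O} : IsTypeFam S T → IsObj S O → IsObj S (Tm.lam T O)
end

mutual
/-- Pre-kinds: `L ::= TYPE | Πx:R.L`. -/
inductive PreKind (S : Sig C) : Tm C → Prop
  | type : PreKind S Tm.type
  | pi {R L} : PreTypeFam S R → PreKind S L → PreKind S (Tm.pi R L)

/-- Pre-type families: `R ::= α[M⃗] | R N | λx:A.R | Πx:R.R` with `α` type-level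
and `M⃗`, `N`, `A` arbitrary. -/
inductive PreTypeFam (S : Sig C) : Tm C → Prop
  | const {c Ms} : TypeLevel S c → PreTypeFam S (Tm.const c Ms)
  | app {R N} : PreTypeFam S R → PreTypeFam S (Tm.app R N)
  | lam {A R} : PreTypeFam S R → PreTypeFam S (Tm.lam A R)
  | pi {R₁ R₂} : PreTypeFam S R₁ → PreTypeFam S R₂ → PreTypeFam S (Tm.pi R₁ R₂)
end

/-- A rewrite rule is type-level when its head constant is type-level. -/
def TypeLevelRule (S : Sig C) (rl : C × List (Tm C) × Tm C) : Prop := TypeLevel S rl.1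

/-- The grammar `R ::= α[M⃗] | R N | λx:A.R` used to define arity preservation. -/
inductive APShape (S : Sig C) : Tm C → Prop
  | const {c Ms} : TypeLevel S c → APShape S (Tm.const c Ms)
  | app {R N} : APShape S R → APShape S (Tm.app R N)
  | lam {A R} : APShape S R → APShape S (Tm.lam A R)

/-- `𝓡` is arity preserving (w.r.t. `Σ`). -/
def ArityPreserving (S : Sig C) (R : Rules C) : Prop :=
  ∀ rl ∈ R, TypeLevelRule S rl → APShape S rl.2.2

/-- `𝓡` is well-formed (w.r.t. `Σ`): right-hand sides of type-level rules are in
the grammar `R ::= α[M⃗] | R N | λx:B.R | Πx:R.R`. -/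
def RulesWellFormed (S : Sig C) (R : Rules C) : Prop :=
  ∀ rl ∈ R, TypeLevelRule S rl → PreTypeFam S rl.2.2

/-! ## Simple types and the erasure maps -/

/-- Simple types `σ ::= * | σ → σ`. -/
inductive STy : Type
  | star : STy
  | arr : STy → STy → STy
deriving DecidableEq

open Classical in
/-- The partial type erasure `⌈·⌉` from Dedukti terms to simple types. -/
noncomputable def tyErase (S : Sig C) : Tm C → Option STy
  | Tm.type => some STy.star
  | Tm.const c _ => if TypeLevel S c then some STy.star else none
  | Tm.pi A B => do return STy.arr (← tyErase S A) (← tyErase S B)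
  | Tm.app A _ => tyErase S A
  | Tm.lam _ B => tyErase S B
  | Tm.var _ => none
  | Tm.kind => none

/-- Untyped λ-terms with constants in `K` (the target of the term erasure). -/
inductive LTm (K : Type) : Type
  | var : Nat → LTm K
  | const : K → LTm K
  | app : LTm K → LTm K → LTm K
  | lam : LTm K → LTm K

namespace LTm
variable {K : Type}

def liftRen' (ρ : Nat → Nat) : Nat → Nat
  | 0 => 0
  | n + 1 => ρ n + 1

def ren (ρ : Nat → Nat) : LTm K → LTm K
  | var n => var (ρ n)
  | const k => const k
  | app M N => app (ren ρ M) (ren ρ N)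
  | lam M => lam (ren (liftRen' ρ) M)

/-- Shift free variables `≥ d` up by one. -/
def shiftAbove (d : Nat) : LTm K → LTm K :=
  ren fun n => if n < d then n else n + 1

def liftSub (σ : Nat → LTm K) : Nat → LTm K
  | 0 => var 0
  | n + 1 => ren Nat.succ (σ n)

def sub (σ : Nat → LTm K) : LTm K → LTm K
  | var n => σ n
  | const k => const k
  | app M N => app (sub σ M) (sub σ N)
  | lam M => lam (sub (liftSub σ) M)

/-- Substitution `M{N/x}` for the variable of index `k`. -/
def substAt (k : Nat) (N : LTm K) : LTm K → LTm K :=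
  sub fun n => if n < k then var n else if n = k then ren (· + k) N else var (n - 1)

end LTm

/-- β-reduction for the (simply-typed) λ-calculus. -/
inductive LBeta {K : Type} : LTm K → LTm K → Prop
  | red {M N} : LBeta (LTm.app (LTm.lam M) N) (LTm.substAt 0 N M)
  | appL {M M' N} : LBeta M M' → LBeta (LTm.app M N) (LTm.app M' N)
  | appR {M N N'} : LBeta N N' → LBeta (LTm.app M N) (LTm.app M N')
  | lam {M M'} : LBeta M M' → LBeta (LTm.lam M) (LTm.lam M')

/-- The partial term erasure `|·|` from Dedukti terms into the λ-calculus with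
constants `C ⊕ STy` (`Sum.inr σ` being the constant `π_σ`). -/
noncomputable def erase (S : Sig C) : Tm C → Option (LTm (C ⊕ STy))
  | Tm.var n => some (LTm.var n)
  | Tm.const c Ms => do
      let ts ← Ms.attach.mapM fun x => erase S x.1
      return ts.foldl LTm.app (LTm.const (Sum.inl c))
  | Tm.app M N => do return LTm.app (← erase S M) (← erase S N)
  | Tm.lam A M => do
      return LTm.app (LTm.lam (LTm.lam (LTm.shiftAbove 1 (← erase S M)))) (← erase S A)
  | Tm.pi A B => do
      return LTm.app (LTm.app (LTm.const (Sum.inr (← tyErase S A))) (← erase S A))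
        (LTm.lam (← erase S B))
  | Tm.type => none
  | Tm.kind => none
termination_by t => sizeOf t
decreasing_by
  all_goals simp_wf
  all_goals try omega
  all_goals (have h := List.sizeOf_lt_of_mem x.2; omega)

/-- The type `* → (σ → *) → *` of the constant `π_σ`. -/
def piConstTy (σ : STy) : STy := STy.arr STy.star (STy.arr (STy.arr σ STy.star) STy.star)

/-- `⌈A₁⌉ → ... → ⌈Aₙ⌉ → ⌈A⌉`, as a relation (defined when all erasures are). -/
inductive EraseTele (S : Sig C) : List (Tm C) → Tm C → STy → Prop
  | nil {A σ} : tyErase S A = some σ → EraseTele S [] A σ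
  | cons {B Δ A τ σ} : tyErase S B = some τ → EraseTele S Δ A σ →
      EraseTele S (B :: Δ) A (STy.arr τ σ)

/-- The simply-typed constant context `Γ_π, ⌈Σ'⌉`: it declares `π_σ : * → (σ → *) → *`
for every simple type `σ`, and `c : ⌈A₁⌉ → ... → ⌈Aₙ⌉ → ⌈A⌉` for every
declaration `c[x₁:A₁,...,xₙ:Aₙ] : A` of `Σ'` (erasures being taken w.r.t. `S`). -/
inductive ConstTy (S : Sig C) (S' : Sig C) : C ⊕ STy → STy → Prop
  | piConst (σ : STy) : ConstTy S S' (Sum.inr σ) (piConstTy σ)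
  | const {c Δ A σ} : (c, Δ, A) ∈ S' → EraseTele S Δ A σ → ConstTy S S' (Sum.inl c) σ

/-- Typing in the simply-typed λ-calculus, with constants typed by `cty`. -/
inductive STTyped {K : Type} (cty : K → STy → Prop) : List STy → LTm K → STy → Prop
  | var {Γ n σ} : Γ[n]? = some σ → STTyped cty Γ (LTm.var n) σ
  | const {Γ k σ} : cty k σ → STTyped cty Γ (LTm.const k) σ
  | app {Γ M N σ τ} : STTyped cty Γ M (STy.arr σ τ) → STTyped cty Γ N σ →
      STTyped cty Γ (LTm.app M N) τ
  | lam {Γ M σ τ} : STTyped cty (σ :: Γ) M τ → STTyped cty Γ (LTm.lam M) (STy.arr σ τ)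

/-! ## Explicitly-typed Pure Type Systems (EPTS) -/

/-- EPTS terms (de Bruijn): `x | s | Π_{s₁,s₂}(A,[x]B) | λ_{s₁,s₂}(A,[x]B,[x]M) |
@_{s₁,s₂}(A,[x]B,M,N)`. -/
inductive ETm (S : Type) : Type
  | var : Nat → ETm S
  | sort : S → ETm S
  | pi : S → S → ETm S → ETm S → ETm S
  | lam : S → S → ETm S → ETm S → ETm S → ETm S
  | app : S → S → ETm S → ETm S → ETm S → ETm S → ETm S

namespace ETm
variable {S : Type}

def ren (ρ : Nat → Nat) : ETm S → ETm S
  | var n => var (ρ n)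
  | sort s => sort s
  | pi s₁ s₂ A B => pi s₁ s₂ (ren ρ A) (ren (Tm.liftRen ρ) B)
  | lam s₁ s₂ A B M => lam s₁ s₂ (ren ρ A) (ren (Tm.liftRen ρ) B) (ren (Tm.liftRen ρ) M)
  | app s₁ s₂ A B M N => app s₁ s₂ (ren ρ A) (ren (Tm.liftRen ρ) B) (ren ρ M) (ren ρ N)

def liftSub (σ : Nat → ETm S) : Nat → ETm S
  | 0 => var 0
  | n + 1 => ren Nat.succ (σ n)

def sub (σ : Nat → ETm S) : ETm S → ETm S
  | var n => σ n
  | sort s => sort s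
  | pi s₁ s₂ A B => pi s₁ s₂ (sub σ A) (sub (liftSub σ) B)
  | lam s₁ s₂ A B M => lam s₁ s₂ (sub σ A) (sub (liftSub σ) B) (sub (liftSub σ) M)
  | app s₁ s₂ A B M N => app s₁ s₂ (sub σ A) (sub (liftSub σ) B) (sub σ M) (sub σ N)

/-- Substitution `M{N/x}` for the variable of de Bruijn index `k`. -/
def substAt (k : Nat) (N : ETm S) : ETm S → ETm S :=
  sub fun n => if n < k then var n else if n = k then ren (· + k) N else var (n - 1)

end ETm

variable {S : Type}

/-- Closure of a root relation under all EPTS term-forming contexts. -/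
inductive ECong (r : ETm S → ETm S → Prop) : ETm S → ETm S → Prop
  | base {M N} : r M N → ECong r M N
  | piA {s₁ s₂ A A' B} : ECong r A A' → ECong r (.pi s₁ s₂ A B) (.pi s₁ s₂ A' B)
  | piB {s₁ s₂ A B B'} : ECong r B B' → ECong r (.pi s₁ s₂ A B) (.pi s₁ s₂ A B')
  | lamA {s₁ s₂ A A' B M} : ECong r A A' → ECong r (.lam s₁ s₂ A B M) (.lam s₁ s₂ A' B M)
  | lamB {s₁ s₂ A B B' M} : ECong r B B' → ECong r (.lam s₁ s₂ A B M) (.lam s₁ s₂ A B' M)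
  | lamM {s₁ s₂ A B M M'} : ECong r M M' → ECong r (.lam s₁ s₂ A B M) (.lam s₁ s₂ A B M')
  | appA {s₁ s₂ A A' B M N} : ECong r A A' → ECong r (.app s₁ s₂ A B M N) (.app s₁ s₂ A' B M N)
  | appB {s₁ s₂ A B B' M N} : ECong r B B' → ECong r (.app s₁ s₂ A B M N) (.app s₁ s₂ A B' M N)
  | appM {s₁ s₂ A B M M' N} : ECong r M M' → ECong r (.app s₁ s₂ A B M N) (.app s₁ s₂ A B M' N)
  | appN {s₁ s₂ A B M N N'} : ECong r N N' → ECong r (.app s₁ s₂ A B M N) (.app s₁ s₂ A B M N')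

/-- Root β-reduction of the EPTS (linearized rule, one instance per `(s₁,s₂,s₃) ∈ ℛ`):
`@_{s₁,s₂}(A,[x]B, λ_{s₁,s₂}(A',[x]B',[x]M), N) ↪ M{N/x}`. -/
def EBetaRoot (Rrel : S → S → S → Prop) : ETm S → ETm S → Prop := fun M N =>
  ∃ s₁ s₂ s₃ A B A' B' P Q, Rrel s₁ s₂ s₃ ∧
    M = ETm.app s₁ s₂ A B (ETm.lam s₁ s₂ A' B' P) Q ∧ N = ETm.substAt 0 Q P

/-- One-step EPTS reduction. -/
def EStep (Rrel : S → S → S → Prop) : ETm S → ETm S → Prop := ECong (EBetaRoot Rrel)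

/-- EPTS conversion `≡`. -/
def EConv (Rrel : S → S → S → Prop) : ETm S → ETm S → Prop := Relation.EqvGen (EStep Rrel)

mutual
/-- Well-formed EPTS contexts. -/
inductive EWf (Ar : S → S → Prop) (Rr : S → S → S → Prop) : List (ETm S) → Prop
  | empty : EWf Ar Rr []
  | decl {Γ A s} : ETyped Ar Rr Γ A (ETm.sort s) → EWf Ar Rr (A :: Γ)

/-- The EPTS typing judgment `Γ ⊢ M : A`. -/
inductive ETyped (Ar : S → S → Prop) (Rr : S → S → S → Prop) : List (ETm S) → ETm S → ETm S → Prop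
  | sort {Γ s₁ s₂} : EWf Ar Rr Γ → Ar s₁ s₂ → ETyped Ar Rr Γ (ETm.sort s₁) (ETm.sort s₂)
  | var {Γ n A} : EWf Ar Rr Γ → Γ[n]? = some A →
      ETyped Ar Rr Γ (ETm.var n) (ETm.ren (· + (n + 1)) A)
  | conv {Γ M A B s} : ETyped Ar Rr Γ M A → ETyped Ar Rr Γ B (ETm.sort s) →
      EConv Rr A B → ETyped Ar Rr Γ M B
  | pi {Γ s₁ s₂ s₃ A B} : Rr s₁ s₂ s₃ → ETyped Ar Rr Γ A (ETm.sort s₁) →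
      ETyped Ar Rr (A :: Γ) B (ETm.sort s₂) →
      ETyped Ar Rr Γ (ETm.pi s₁ s₂ A B) (ETm.sort s₃)
  | lam {Γ s₁ s₂ s₃ A B M} : Rr s₁ s₂ s₃ → ETyped Ar Rr Γ A (ETm.sort s₁) →
      ETyped Ar Rr (A :: Γ) B (ETm.sort s₂) → ETyped Ar Rr (A :: Γ) M B →
      ETyped Ar Rr Γ (ETm.lam s₁ s₂ A B M) (ETm.pi s₁ s₂ A B)
  | app {Γ s₁ s₂ s₃ A B M N} : Rr s₁ s₂ s₃ → ETyped Ar Rr Γ A (ETm.sort s₁) →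
      ETyped Ar Rr (A :: Γ) B (ETm.sort s₂) → ETyped Ar Rr Γ N A →
      ETyped Ar Rr Γ M (ETm.pi s₁ s₂ A B) →
      ETyped Ar Rr Γ (ETm.app s₁ s₂ A B M N) (ETm.substAt 0 N B)
end

/-- `𝒜` and `ℛ` are functional relations. -/
def FunctionalSpec (Ar : S → S → Prop) (Rr : S → S → S → Prop) : Prop :=
  (∀ s t t', Ar s t → Ar s t' → t = t') ∧
  (∀ s₁ s₂ t t', Rr s₁ s₂ t → Rr s₁ s₂ t' → t = t')

/-- `s` is a top-sort. -/
def IsTopSort (Ar : S → S → Prop) (s : S) : Prop := ¬ ∃ s', Ar s s'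

/-- `Γ ⊢ A type`: `A` is a sort, or `Γ ⊢ A : s` for some sort `s`. -/
def ETypeJ (Ar : S → S → Prop) (Rr : S → S → S → Prop) (Γ : List (ETm S)) (A : ETm S) : Prop :=
  (∃ s, A = ETm.sort s) ∨ ∃ s, ETyped Ar Rr Γ A (ETm.sort s)

/-! ## (Implicit) Pure Type Systems -/

/-- PTS terms. -/
inductive PTm (S : Type) : Type
  | var : Nat → PTm S
  | sort : S → PTm S
  | pi : PTm S → PTm S → PTm S
  | lam : PTm S → PTm S → PTm S
  | app : PTm S → PTm S → PTm S

namespace PTm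
variable {S : Type}

def ren (ρ : Nat → Nat) : PTm S → PTm S
  | var n => var (ρ n)
  | sort s => sort s
  | pi A B => pi (ren ρ A) (ren (Tm.liftRen ρ) B)
  | lam A M => lam (ren ρ A) (ren (Tm.liftRen ρ) M)
  | app M N => app (ren ρ M) (ren ρ N)

def liftSub (σ : Nat → PTm S) : Nat → PTm S
  | 0 => var 0
  | n + 1 => ren Nat.succ (σ n)

def sub (σ : Nat → PTm S) : PTm S → PTm S
  | var n => σ n
  | sort s => sort s
  | pi A B => pi (sub σ A) (sub (liftSub σ) B)
  | lam A M => lam (sub σ A) (sub (liftSub σ) M)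
  | app M N => app (sub σ M) (sub σ N)

def substAt (k : Nat) (N : PTm S) : PTm S → PTm S :=
  sub fun n => if n < k then var n else if n = k then ren (· + k) N else var (n - 1)

end PTm

/-- One-step β-reduction of PTS terms. -/
inductive PBeta : PTm S → PTm S → Prop
  | red {A M N} : PBeta (PTm.app (PTm.lam A M) N) (PTm.substAt 0 N M)
  | piA {A A' B} : PBeta A A' → PBeta (PTm.pi A B) (PTm.pi A' B)
  | piB {A B B'} : PBeta B B' → PBeta (PTm.pi A B) (PTm.pi A B')
  | lamA {A A' M} : PBeta A A' → PBeta (PTm.lam A M) (PTm.lam A' M)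
  | lamM {A M M'} : PBeta M M' → PBeta (PTm.lam A M) (PTm.lam A M')
  | appL {M M' N} : PBeta M M' → PBeta (PTm.app M N) (PTm.app M' N)
  | appR {M N N'} : PBeta N N' → PBeta (PTm.app M N) (PTm.app M N')

/-- PTS conversion. -/
def PConv : PTm S → PTm S → Prop := Relation.EqvGen PBeta

mutual
/-- Well-formed PTS contexts. -/
inductive PWf (Ar : S → S → Prop) (Rr : S → S → S → Prop) : List (PTm S) → Prop
  | empty : PWf Ar Rr []
  | decl {Γ A s} : PTyped Ar Rr Γ A (PTm.sort s) → PWf Ar Rr (A :: Γ)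

/-- The PTS typing judgment. -/
inductive PTyped (Ar : S → S → Prop) (Rr : S → S → S → Prop) : List (PTm S) → PTm S → PTm S → Prop
  | sort {Γ s₁ s₂} : PWf Ar Rr Γ → Ar s₁ s₂ → PTyped Ar Rr Γ (PTm.sort s₁) (PTm.sort s₂)
  | var {Γ n A} : PWf Ar Rr Γ → Γ[n]? = some A →
      PTyped Ar Rr Γ (PTm.var n) (PTm.ren (· + (n + 1)) A)
  | conv {Γ M A B s} : PTyped Ar Rr Γ M A → PTyped Ar Rr Γ B (PTm.sort s) →
      PConv A B → PTyped Ar Rr Γ M B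
  | pi {Γ s₁ s₂ s₃ A B} : Rr s₁ s₂ s₃ → PTyped Ar Rr Γ A (PTm.sort s₁) →
      PTyped Ar Rr (A :: Γ) B (PTm.sort s₂) →
      PTyped Ar Rr Γ (PTm.pi A B) (PTm.sort s₃)
  | lam {Γ s₁ s₂ s₃ A B M} : Rr s₁ s₂ s₃ → PTyped Ar Rr Γ A (PTm.sort s₁) →
      PTyped Ar Rr (A :: Γ) B (PTm.sort s₂) → PTyped Ar Rr (A :: Γ) M B →
      PTyped Ar Rr Γ (PTm.lam A M) (PTm.pi A B)
  | app {Γ A B M N} : PTyped Ar Rr Γ M (PTm.pi A B) → PTyped Ar Rr Γ N A →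
      PTyped Ar Rr Γ (PTm.app M N) (PTm.substAt 0 N B)
end

/-- `Γ ⊢_PTS A type`. -/
def PTypeJ (Ar : S → S → Prop) (Rr : S → S → S → Prop) (Γ : List (PTm S)) (A : PTm S) : Prop :=
  (∃ s, A = PTm.sort s) ∨ ∃ s, PTyped Ar Rr Γ A (PTm.sort s)

/-- The natural erasure from EPTS terms to PTS terms. -/
def epsErase : ETm S → PTm S
  | ETm.var n => PTm.var n
  | ETm.sort s => PTm.sort s
  | ETm.pi _ _ A B => PTm.pi (epsErase A) (epsErase B)
  | ETm.lam _ _ A _ M => PTm.lam (epsErase A) (epsErase M)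
  | ETm.app _ _ _ _ M N => PTm.app (epsErase M) (epsErase N)

/-! ## The encoding of EPTSs in Dedukti -/

/-- The constants of the theory `(Σ_EPTS, 𝓡_EPTS)`. -/
inductive EConst (S : Type) : Type
  | U : S → EConst S
  | El : S → EConst S
  | u : S → EConst S
  | Prod : S → S → EConst S
  | abs : S → S → EConst S
  | app : S → S → EConst S

/-- `U_s`. -/
def Ucon (s : S) : Tm (EConst S) := Tm.const (EConst.U s) []
/-- `El_s A`. -/
def Elcon (s : S) (A : Tm (EConst S)) : Tm (EConst S) := Tm.const (EConst.El s) [A]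
/-- `u_s`. -/
def ucon (s : S) : Tm (EConst S) := Tm.const (EConst.u s) []
/-- `Prod_{s₁,s₂} A B`. -/
def ProdC (s₁ s₂ : S) (A B : Tm (EConst S)) : Tm (EConst S) :=
  Tm.const (EConst.Prod s₁ s₂) [A, B]
/-- `abs_{s₁,s₂} A B M`. -/
def absC (s₁ s₂ : S) (A B M : Tm (EConst S)) : Tm (EConst S) :=
  Tm.const (EConst.abs s₁ s₂) [A, B, M]
/-- `app_{s₁,s₂} A B M N`. -/
def appC (s₁ s₂ : S) (A B M N : Tm (EConst S)) : Tm (EConst S) :=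
  Tm.const (EConst.app s₁ s₂) [A, B, M, N]

/-- The signature `Σ_EPTS` (telescopes in de Bruijn form). -/
inductive SigEPTSMem (Ar : S → S → Prop) (Rr : S → S → S → Prop) :
    EConst S × List (Tm (EConst S)) × Tm (EConst S) → Prop
  | U (s : S) : SigEPTSMem Ar Rr (EConst.U s, [], Tm.type)
  | El (s : S) : SigEPTSMem Ar Rr (EConst.El s, [Ucon s], Tm.type)
  | u {s₁ s₂} : Ar s₁ s₂ → SigEPTSMem Ar Rr (EConst.u s₁, [], Ucon s₂)
  | Prod {s₁ s₂ s₃} : Rr s₁ s₂ s₃ →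
      SigEPTSMem Ar Rr (EConst.Prod s₁ s₂,
        [Ucon s₁, Tm.pi (Elcon s₁ (Tm.var 0)) (Ucon s₂)],
        Ucon s₃)
  | abs {s₁ s₂ s₃} : Rr s₁ s₂ s₃ →
      SigEPTSMem Ar Rr (EConst.abs s₁ s₂,
        [Ucon s₁, Tm.pi (Elcon s₁ (Tm.var 0)) (Ucon s₂),
         Tm.pi (Elcon s₁ (Tm.var 1)) (Elcon s₂ (Tm.app (Tm.var 1) (Tm.var 0)))],
        Elcon s₃ (ProdC s₁ s₂ (Tm.var 2) (Tm.var 1)))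
  | app {s₁ s₂ s₃} : Rr s₁ s₂ s₃ →
      SigEPTSMem Ar Rr (EConst.app s₁ s₂,
        [Ucon s₁, Tm.pi (Elcon s₁ (Tm.var 0)) (Ucon s₂),
         Elcon s₃ (ProdC s₁ s₂ (Tm.var 1) (Tm.var 0)),
         Elcon s₁ (Tm.var 2)],
        Elcon s₂ (Tm.app (Tm.var 2) (Tm.var 0)))

/-- `Σ_EPTS` as a signature. -/
def sigEPTS (Ar : S → S → Prop) (Rr : S → S → S → Prop) : Sig (EConst S) :=
  fun e => SigEPTSMem Ar Rr e

/-- The rules `El_{s₂} u_{s₁} ↪ U_{s₁}` for `(s₁,s₂) ∈ 𝒜`. -/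
inductive URulesMem (Ar : S → S → Prop) :
    EConst S × List (Tm (EConst S)) × Tm (EConst S) → Prop
  | u_red {s₁ s₂} : Ar s₁ s₂ → URulesMem Ar (EConst.El s₂, [ucon s₁], Ucon s₁)

/-- The rules `app_{s₁,s₂} A B (abs_{s₁,s₂} A' B' M) N ↪ M N` for `(s₁,s₂,s₃) ∈ ℛ`
(pattern variables `A,B,A',B',M,N` are the de Bruijn variables `0,…,5`). -/
inductive BetaRulesMem (Rr : S → S → S → Prop) :
    EConst S × List (Tm (EConst S)) × Tm (EConst S) → Prop
  | beta {s₁ s₂ s₃} : Rr s₁ s₂ s₃ →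
      BetaRulesMem Rr (EConst.app s₁ s₂,
        [Tm.var 0, Tm.var 1, absC s₁ s₂ (Tm.var 2) (Tm.var 3) (Tm.var 4), Tm.var 5],
        Tm.app (Tm.var 4) (Tm.var 5))

/-- The `u_{s₁}`-red rules as a rule set. -/
def uRules (Ar : S → S → Prop) : Rules (EConst S) := fun e => URulesMem Ar e

/-- The `beta_{s₁,s₂}` rules as a rule set. -/
def betaRules (Rr : S → S → S → Prop) : Rules (EConst S) := fun e => BetaRulesMem Rr e

/-- The rewrite system `𝓡_EPTS`. -/
def rulesEPTS (Ar : S → S → Prop) (Rr : S → S → S → Prop) : Rules (EConst S) :=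
  uRules Ar ∪ betaRules Rr

/-- The translation `⟦·⟧` from EPTS terms to Dedukti terms. -/
def trans : ETm S → Tm (EConst S)
  | ETm.var n => Tm.var n
  | ETm.sort s => ucon s
  | ETm.pi s₁ s₂ A B =>
      ProdC s₁ s₂ (trans A) (Tm.lam (Elcon s₁ (trans A)) (trans B))
  | ETm.lam s₁ s₂ A B M =>
      absC s₁ s₂ (trans A) (Tm.lam (Elcon s₁ (trans A)) (trans B))
        (Tm.lam (Elcon s₁ (trans A)) (trans M))
  | ETm.app s₁ s₂ A B M N =>
      appC s₁ s₂ (trans A) (Tm.lam (Elcon s₁ (trans A)) (trans B)) (trans M) (trans N)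

/-- The translation `⟦·⟧` on (well-formed) contexts: `⟦Γ, x:A⟧ = ⟦Γ⟧, x : El_{s_A} ⟦A⟧`
where `Γ ⊢ A : s_A`. -/
inductive TransCtx (Ar : S → S → Prop) (Rr : S → S → S → Prop) :
    List (ETm S) → List (Tm (EConst S)) → Prop
  | nil : TransCtx Ar Rr [] []
  | cons {Γ Δ A sA} : TransCtx Ar Rr Γ Δ → ETyped Ar Rr Γ A (ETm.sort sA) →
      TransCtx Ar Rr (A :: Γ) (Elcon sA (trans A) :: Δ)

/-- Invertible forms. -/
inductive Invertible : Tm (EConst S) → Prop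
  | var {n} : Invertible (Tm.var n)
  | u {s} : Invertible (ucon s)
  | abs {s₁ s₂ A T₁ B T₂ M} : Invertible A → Invertible B → Invertible M →
      Invertible (absC s₁ s₂ A (Tm.lam T₁ B) (Tm.lam T₂ M))
  | beta {T M N} : Invertible M → Invertible N →
      Invertible (Tm.app (Tm.lam T M) N)
  | prod {s₁ s₂ A T₁ B} : Invertible A → Invertible B →
      Invertible (ProdC s₁ s₂ A (Tm.lam T₁ B))
  | app {s₁ s₂ A T₁ B M N} : Invertible A → Invertible B → Invertible M → Invertible N →
      Invertible (appC s₁ s₂ A (Tm.lam T₁ B) M N)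

/-- The inverse translation `|·|`, defined (at least) on invertible forms. -/
def inv : Tm (EConst S) → Option (ETm S)
  | Tm.var n => some (ETm.var n)
  | Tm.const (EConst.u s) [] => some (ETm.sort s)
  | Tm.app (Tm.lam _ M) N => do
      return ETm.substAt 0 (← inv N) (← inv M)
  | Tm.const (EConst.Prod s₁ s₂) [A, Tm.lam _ B] => do
      return ETm.pi s₁ s₂ (← inv A) (← inv B)
  | Tm.const (EConst.abs s₁ s₂) [A, Tm.lam _ B, Tm.lam _ M] => do
      return ETm.lam s₁ s₂ (← inv A) (← inv B) (← inv M)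
  | Tm.const (EConst.app s₁ s₂) [A, Tm.lam _ B, M, N] => do
      return ETm.app s₁ s₂ (← inv A) (← inv B) (← inv M) (← inv N)
  | _ => none
termination_by t => sizeOf t
decreasing_by
  all_goals simp_wf
  all_goals omega

/-- Hidden rewriting steps: a `↪_{β𝓡}` step inside the type annotation of a binder. -/
def HStep (R : Rules (EConst S)) : Tm (EConst S) → Tm (EConst S) → Prop :=
  Cong fun M N => ∃ A A' P, Step R A A' ∧ M = Tm.lam A P ∧ N = Tm.lam A' P

/-- The hidden conversion `≡_H`. -/
def HConv (R : Rules (EConst S)) : Tm (EConst S) → Tm (EConst S) → Prop :=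
  Relation.EqvGen (HStep R)


/-! ## Renaming and substitution calculus -/

namespace Tm
variable {C : Type}

theorem induct {P : Tm C → Prop} (var : ∀ n, P (var n))
    (const : ∀ c Ms, (∀ M ∈ Ms, P M) → P (const c Ms)) (type : P type) (kind : P kind)
    (app : ∀ M N, P M → P N → P (app M N)) (lam : ∀ A M, P A → P M → P (lam A M))
    (pi : ∀ A B, P A → P B → P (pi A B)) (M : Tm C) : P M :=
  Tm.rec (motive_1 := P) (motive_2 := fun Ms => ∀ M ∈ Ms, P M) var const type kind app lam pi
    (by simp) (fun _ _ h hs => by simpa using ⟨h, hs⟩) M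

@[simp] theorem ren_const (ρ : Nat → Nat) (c : C) (Ms : List (Tm C)) :
    ren ρ (const c Ms) = const c (Ms.map (ren ρ)) := by
  rw [ren, List.attach_map_val (f := ren ρ)]

@[simp] theorem sub_const (σ : Nat → Tm C) (c : C) (Ms : List (Tm C)) :
    sub σ (const c Ms) = const c (Ms.map (sub σ)) := by
  rw [sub, List.attach_map_val (f := sub σ)]

@[simp] theorem ren_var (ρ : Nat → Nat) (n : Nat) : ren ρ (var n : Tm C) = var (ρ n) := by
  rw [ren]
@[simp] theorem ren_type (ρ : Nat → Nat) : ren ρ (type : Tm C) = type := by rw [ren]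
@[simp] theorem ren_kind (ρ : Nat → Nat) : ren ρ (kind : Tm C) = kind := by rw [ren]
@[simp] theorem ren_app (ρ : Nat → Nat) (M N : Tm C) :
    ren ρ (app M N) = app (ren ρ M) (ren ρ N) := by rw [ren]
@[simp] theorem ren_lam (ρ : Nat → Nat) (A M : Tm C) :
    ren ρ (lam A M) = lam (ren ρ A) (ren (liftRen ρ) M) := by rw [ren]
@[simp] theorem ren_pi (ρ : Nat → Nat) (A B : Tm C) :
    ren ρ (pi A B) = pi (ren ρ A) (ren (liftRen ρ) B) := by rw [ren]
@[simp] theorem sub_var (σ : Nat → Tm C) (n : Nat) : sub σ (var n) = σ n := by rw [sub]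
@[simp] theorem sub_type (σ : Nat → Tm C) : sub σ type = type := by rw [sub]
@[simp] theorem sub_kind (σ : Nat → Tm C) : sub σ kind = kind := by rw [sub]
@[simp] theorem sub_app (σ : Nat → Tm C) (M N : Tm C) :
    sub σ (app M N) = app (sub σ M) (sub σ N) := by rw [sub]
@[simp] theorem sub_lam (σ : Nat → Tm C) (A M : Tm C) :
    sub σ (lam A M) = lam (sub σ A) (sub (liftSub σ) M) := by rw [sub]
@[simp] theorem sub_pi (σ : Nat → Tm C) (A B : Tm C) :
    sub σ (pi A B) = pi (sub σ A) (sub (liftSub σ) B) := by rw [sub]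

theorem liftRen_comp (ρ ρ' : Nat → Nat) : liftRen ρ ∘ liftRen ρ' = liftRen (ρ ∘ ρ') := by
  funext n; cases n <;> rfl

theorem liftSub_comp_liftRen (σ : Nat → Tm C) (ρ : Nat → Nat) :
    liftSub σ ∘ liftRen ρ = liftSub (σ ∘ ρ) := by
  funext n; cases n <;> rfl

theorem liftSub_var : liftSub (var : Nat → Tm C) = var := by
  funext n; cases n <;> simp [liftSub]

theorem ren_ren (M : Tm C) : ∀ ρ ρ' : Nat → Nat, ren ρ (ren ρ' M) = ren (ρ ∘ ρ') M := by
  induction M using induct with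
  | const c Ms ih => intro ρ ρ'; simpa using fun M hM => ih M hM ρ ρ'
  | _ => simp_all [liftRen_comp]

theorem sub_ren (M : Tm C) :
    ∀ (σ : Nat → Tm C) (ρ : Nat → Nat), sub σ (ren ρ M) = sub (σ ∘ ρ) M := by
  induction M using induct with
  | const c Ms ih => intro σ ρ; simpa using fun M hM => ih M hM σ ρ
  | _ => simp_all [liftSub_comp_liftRen]

theorem ren_comp_liftSub (ρ : Nat → Nat) (σ : Nat → Tm C) :
    ren (liftRen ρ) ∘ liftSub σ = liftSub (ren ρ ∘ σ) := by
  funext n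
  cases n with
  | zero => simp [liftSub, liftRen]
  | succ n =>
    simp only [Function.comp_apply, liftSub, ren_ren]
    rfl

theorem ren_sub (M : Tm C) :
    ∀ (ρ : Nat → Nat) (σ : Nat → Tm C), ren ρ (sub σ M) = sub (ren ρ ∘ σ) M := by
  induction M using induct with
  | const c Ms ih => intro ρ σ; simpa using fun M hM => ih M hM ρ σ
  | _ => simp_all [ren_comp_liftSub]

theorem sub_comp_liftSub (σ τ : Nat → Tm C) :
    sub (liftSub σ) ∘ liftSub τ = liftSub (sub σ ∘ τ) := by
  funext n
  cases n with
  | zero => simp [liftSub]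
  | succ n =>
    simp only [Function.comp_apply, liftSub, ren_sub, sub_ren]
    rfl

theorem sub_sub (M : Tm C) : ∀ σ τ : Nat → Tm C, sub σ (sub τ M) = sub (sub σ ∘ τ) M := by
  induction M using induct with
  | const c Ms ih => intro σ τ; simpa using fun M hM => ih M hM σ τ
  | _ => simp_all [sub_comp_liftSub]

theorem sub_id (M : Tm C) : sub var M = M := by
  induction M using induct with
  | const c Ms ih => rw [sub_const, List.map_congr_left ih, List.map_id']
  | _ => simp_all [liftSub_var]

theorem ren_eq_sub (ρ : Nat → Nat) (M : Tm C) : ren ρ M = sub (var ∘ ρ) M := by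
  rw [← sub_ren, sub_id]

theorem ren_id (M : Tm C) : ren (fun n => n) M = M := by
  rw [ren_eq_sub]; exact sub_id M

theorem ren_substAt_zero (ρ : Nat → Nat) (N M : Tm C) :
    ren ρ (substAt 0 N M) = substAt 0 (ren ρ N) (ren (liftRen ρ) M) := by
  simp only [substAt, ren_sub, sub_ren]
  congr 1; funext n
  cases n <;> simp [liftRen, ren_id]

theorem sub_substAt_zero (σ : Nat → Tm C) (N M : Tm C) :
    sub σ (substAt 0 N M) = substAt 0 (sub σ N) (sub (liftSub σ) M) := by
  simp only [substAt, sub_sub]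
  congr 1; funext n
  cases n with
  | zero => simp [liftSub, ren_id]
  | succ n =>
    simp only [Function.comp_apply, liftSub, sub_ren]
    exact ((sub_var σ n).trans (sub_id (σ n)).symm :)

theorem iterate_liftRen (ρ : Nat → Nat) (i n : Nat) :
    liftRen^[i] ρ n = if n < i then n else ρ (n - i) + i := by
  induction i generalizing n with
  | zero => simp
  | succ i ih =>
    rw [Function.iterate_succ_apply']
    cases n with
    | zero => simp [liftRen]
    | succ n =>
      simp only [liftRen, ih, Nat.succ_lt_succ_iff, Nat.succ_sub_succ]
      split <;> omega

theorem ren_substAt (ρ : Nat → Nat) (i : Nat) (N M : Tm C) :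
    ren (liftRen^[i] ρ) (substAt i N M) = substAt i (ren ρ N) (ren (liftRen^[i + 1] ρ) M) := by
  simp only [substAt, ren_sub, sub_ren]
  congr 1; funext n
  simp only [Function.comp_apply, iterate_liftRen]
  rcases lt_trichotomy n i with h | rfl | h
  · simp [h, Nat.lt_succ_of_lt h, iterate_liftRen]
  · simp only [lt_irrefl, if_true, if_false, ren_ren, Nat.lt_succ_self]
    congr 1; funext m
    simp [iterate_liftRen]
  · have h₁ : ¬ n < i := by omega
    have h₂ : n ≠ i := by omega
    have h₃ : ¬ n < i + 1 := by omega
    have h₄ : ¬ n - 1 < i := by omega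
    simp only [h₁, h₂, h₃, if_false, ren_var, iterate_liftRen, h₄]
    have h₅ : n - (i + 1) = n - 1 - i := by omega
    rw [h₅, if_neg (by omega), if_neg (by omega)]
    rfl

/-- Renaming of a telescope. -/
def renTele (ρ : Nat → Nat) (Δ : List (Tm C)) : List (Tm C) :=
  Δ.mapIdx fun i B => ren (liftRen^[i] ρ) B

theorem renTele_cons (ρ : Nat → Nat) (A : Tm C) (Δ : List (Tm C)) :
    renTele ρ (A :: Δ) = ren ρ A :: renTele (liftRen ρ) Δ := by
  simp [renTele, List.mapIdx_cons]

theorem renTele_instTele (ρ : Nat → Nat) (M : Tm C) (Δ : List (Tm C)) :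
    renTele ρ (instTele M Δ) = instTele (ren ρ M) (renTele (liftRen ρ) Δ) := by
  simp only [renTele, instTele, List.mapIdx_mapIdx]
  congr 1; funext i B
  exact ren_substAt ρ i M B

theorem ren_instArgs (ρ : Nat → Nat) (Ms : List (Tm C)) (A : Tm C) :
    ren ρ (instArgs Ms A) = instArgs (Ms.map (ren ρ)) (ren (liftRen^[Ms.length] ρ) A) := by
  simp only [instArgs, ren_sub, sub_ren]
  congr 1; funext n
  simp only [Function.comp_apply, iterate_liftRen, List.length_map, ← List.map_reverse,
    List.getD_eq_getElem?_getD, List.getElem?_map]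
  by_cases h : n < Ms.length
  · simp [h]
  · simp [h]

end Tm

/-! ## Conversion -/

section Conversion
variable {C : Type} {R : Rules C}

theorem Cong.ren {r : Tm C → Tm C → Prop}
    (hr : ∀ (ρ : Nat → Nat) M N, r M N → r (Tm.ren ρ M) (Tm.ren ρ N)) {M N : Tm C}
    (h : Cong r M N) : ∀ ρ : Nat → Nat, Cong r (Tm.ren ρ M) (Tm.ren ρ N) := by
  induction h with
  | base h => exact fun ρ => .base (hr ρ _ _ h)
  | appL _ ih => intro ρ; simpa using .appL (ih ρ)
  | appR _ ih => intro ρ; simpa using .appR (ih ρ)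
  | lamA _ ih => intro ρ; simpa using .lamA (ih ρ)
  | lamM _ ih => intro ρ; simpa using .lamM (ih _)
  | piA _ ih => intro ρ; simpa using .piA (ih ρ)
  | piB _ ih => intro ρ; simpa using .piB (ih _)
  | constArg _ ih => intro ρ; simpa using .constArg (ih ρ)

theorem Step.ren {M N : Tm C} (h : Step R M N) (ρ : Nat → Nat) :
    Step R (Tm.ren ρ M) (Tm.ren ρ N) := by
  refine Cong.ren ?_ h ρ
  rintro ρ M N (⟨A, P, Q, rfl, rfl⟩ | ⟨rl, hrl, σ, rfl, rfl⟩)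
  · exact .inl ⟨Tm.ren ρ A, _, _, by simp only [Tm.ren_app, Tm.ren_lam],
      Tm.ren_substAt_zero ..⟩
  · exact .inr ⟨rl, hrl, Tm.ren ρ ∘ σ, Tm.ren_sub .., Tm.ren_sub ..⟩

theorem Conv.refl (M : Tm C) : Conv R M M := Relation.EqvGen.refl M
theorem Conv.symm {M N : Tm C} (h : Conv R M N) : Conv R N M := Relation.EqvGen.symm _ _ h
theorem Conv.trans {M N P : Tm C} (h : Conv R M N) (h' : Conv R N P) : Conv R M P :=
  Relation.EqvGen.trans _ _ _ h h'

theorem Conv.map {f : Tm C → Tm C} (hf : ∀ M N, Step R M N → Step R (f M) (f N)) {M N : Tm C}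
    (h : Conv R M N) : Conv R (f M) (f N) := by
  induction h with
  | rel _ _ h => exact .rel _ _ (hf _ _ h)
  | refl => exact .refl _
  | symm _ _ _ ih => exact ih.symm
  | trans _ _ _ _ _ ih₁ ih₂ => exact ih₁.trans ih₂

theorem Conv.ren {M N : Tm C} (h : Conv R M N) (ρ : Nat → Nat) :
    Conv R (Tm.ren ρ M) (Tm.ren ρ N) :=
  h.map fun _ _ h => h.ren ρ

theorem Conv.app {M M' N N' : Tm C} (h : Conv R M M') (h' : Conv R N N') :
    Conv R (.app M N) (.app M' N') :=
  (h.map (f := (Tm.app · N)) fun _ _ h => .appL h).trans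
    (h'.map (f := Tm.app M') fun _ _ h => .appR h)

theorem Conv.lam {A A' M M' : Tm C} (h : Conv R A A') (h' : Conv R M M') :
    Conv R (.lam A M) (.lam A' M') :=
  (h.map (f := (Tm.lam · M)) fun _ _ h => .lamA h).trans
    (h'.map (f := Tm.lam A') fun _ _ h => .lamM h)

theorem Conv.pi {A A' B B' : Tm C} (h : Conv R A A') (h' : Conv R B B') :
    Conv R (.pi A B) (.pi A' B') :=
  (h.map (f := (Tm.pi · B)) fun _ _ h => .piA h).trans
    (h'.map (f := Tm.pi A') fun _ _ h => .piB h)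

theorem Conv.const_cons {c : C} {l Ms Ns : List (Tm C)} {M N : Tm C} (h : Conv R M N)
    (hs : ∀ l, Conv R (.const c (l ++ Ms)) (.const c (l ++ Ns))) :
    Conv R (.const c (l ++ M :: Ms)) (.const c (l ++ N :: Ns)) :=
  (h.map (f := fun M => Tm.const c (l ++ M :: Ms)) fun _ _ h => .constArg h).trans
    (by simpa using hs (l ++ [N]))

end Conversion

/-! ## Weakening and conversion of contexts -/

section Weakening
variable {C : Type} {Sg : Sig C} {R : Rules C}

/-- Induction on typing derivations, with a second motive for lists of arguments. -/
theorem Typed.induct {P : ∀ Γ M T, Typed Sg R Γ M T → Prop}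
    {Q : List (Tm C) → List (Tm C) → List (Tm C) → Prop}
    (sort : ∀ {Γ} (hw : Wf Sg R Γ), P Γ .type .kind (.sort hw))
    (var : ∀ {Γ n A} (hw : Wf Sg R Γ) (hn : Γ[n]? = some A), P Γ _ _ (.var hw hn))
    (cons : ∀ {Γ c Δ A s Ms} (hc : (c, Δ, A) ∈ Sg) (hA : Typed Sg R Δ.reverse A s)
      (hs : IsDKSort s) (hMs : TypedArgs Sg R Γ Ms Δ), Q Γ Ms Δ →
      P Γ _ _ (.cons hc hA hs hMs))
    (conv : ∀ {Γ M A B s} (hM : Typed Sg R Γ M A) (hB : Typed Sg R Γ B s) (hs : IsDKSort s)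
      (hAB : Conv R A B), P Γ M A hM → P Γ B s hB → P Γ M B (.conv hM hB hs hAB))
    (prod : ∀ {Γ A B s} (hA : Typed Sg R Γ A .type) (hB : Typed Sg R (A :: Γ) B s)
      (hs : IsDKSort s), P Γ A .type hA → P (A :: Γ) B s hB → P Γ _ _ (.prod hA hB hs))
    (abs : ∀ {Γ A B s M} (hA : Typed Sg R Γ A .type) (hB : Typed Sg R (A :: Γ) B s)
      (hs : IsDKSort s) (hM : Typed Sg R (A :: Γ) M B), P Γ A .type hA → P (A :: Γ) B s hB →
      P (A :: Γ) M B hM → P Γ _ _ (.abs hA hB hs hM))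
    (app : ∀ {Γ M N A B} (hM : Typed Sg R Γ M (.pi A B)) (hN : Typed Sg R Γ N A),
      P Γ M (.pi A B) hM → P Γ N A hN → P Γ _ _ (.app hM hN))
    (args_nil : ∀ {Γ}, Q Γ [] [])
    (args_cons : ∀ {Γ M Ms A Δ} (hM : Typed Sg R Γ M A),
      TypedArgs Sg R Γ Ms (instTele M Δ) → P Γ M A hM → Q Γ Ms (instTele M Δ) →
      Q Γ (M :: Ms) (A :: Δ))
    {Γ : List (Tm C)} {M T : Tm C} (h : Typed Sg R Γ M T) : P Γ M T h :=
  Typed.rec (motive_1 := fun _ _ => True) (motive_2 := P)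
    (motive_3 := fun Γ Ms Δ _ => Q Γ Ms Δ) trivial (fun _ _ => trivial)
    (fun hw _ => sort hw) (fun hw hn _ => var hw hn)
    (fun hc hA hs hMs _ ih => cons hc hA hs hMs ih) conv prod abs app args_nil args_cons h

/-- The declarations of `Sg` have no free variables other than those of their telescopes. -/
def SigClosed (Sg : Sig C) : Prop :=
  ∀ c Δ A, (c, Δ, A) ∈ Sg → ∀ ρ : Nat → Nat,
    Tm.renTele ρ Δ = Δ ∧ Tm.ren (Tm.liftRen^[Δ.length] ρ) A = A

/-- `ρ` maps the variables of `Γ` to variables of `Γ'` declared with the renamed type. -/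
def CtxRen (ρ : Nat → Nat) (Γ Γ' : List (Tm C)) : Prop :=
  ∀ n A, Γ[n]? = some A → ∃ A', Γ'[ρ n]? = some A' ∧
    Tm.ren (· + (ρ n + 1)) A' = Tm.ren ρ (Tm.ren (· + (n + 1)) A)

theorem CtxRen.lift {ρ : Nat → Nat} {Γ Γ' : List (Tm C)} (h : CtxRen ρ Γ Γ') (A : Tm C) :
    CtxRen (Tm.liftRen ρ) (A :: Γ) (Tm.ren ρ A :: Γ') := by
  rintro (_ | n) B hB
  · obtain rfl : A = B := by simpa using hB
    refine ⟨Tm.ren ρ A, by simp [Tm.liftRen], ?_⟩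
    simp only [Tm.ren_ren]
    rfl
  · obtain ⟨B', hB', e⟩ := h n B (by simpa using hB)
    refine ⟨B', by simpa [Tm.liftRen] using hB', ?_⟩
    have e' := congrArg (Tm.ren Nat.succ) e
    simp only [Tm.ren_ren] at e' ⊢
    exact e'

theorem CtxRen.succ (A : Tm C) (Γ : List (Tm C)) : CtxRen Nat.succ Γ (A :: Γ) := by
  intro n B hB
  refine ⟨B, by simpa using hB, ?_⟩
  simp only [Tm.ren_ren]
  rfl

theorem IsDKSort.ren {s : Tm C} (h : IsDKSort s) (ρ : Nat → Nat) : Tm.ren ρ s = s := by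
  rcases h with rfl | rfl <;> simp

theorem TypedArgs.length_eq {Γ Ms Δ : List (Tm C)} (h : TypedArgs Sg R Γ Ms Δ) :
    Ms.length = Δ.length := by
  induction Ms generalizing Δ with
  | nil => cases h; rfl
  | cons M Ms ih => cases h with | cons _ h => simpa [instTele] using ih h

theorem Typed.ren (hSg : SigClosed Sg) {Γ : List (Tm C)} {M T : Tm C} (h : Typed Sg R Γ M T) :
    ∀ {Γ' : List (Tm C)} {ρ : Nat → Nat}, Wf Sg R Γ' → CtxRen ρ Γ Γ' →
      Typed Sg R Γ' (Tm.ren ρ M) (Tm.ren ρ T) := by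
  induction h using Typed.induct
    (Q := fun Γ Ms Δ => ∀ {Γ' : List (Tm C)} {ρ : Nat → Nat}, Wf Sg R Γ' →
      CtxRen ρ Γ Γ' → TypedArgs Sg R Γ' (Ms.map (Tm.ren ρ)) (Tm.renTele ρ Δ)) with
  | sort => intro Γ' ρ hw _; simpa using .sort hw
  | var _ hn =>
    intro Γ' ρ hw hρ
    obtain ⟨A', hA', e⟩ := hρ _ _ hn
    rw [Tm.ren_var, ← e]
    exact .var hw hA'
  | cons hc hA hs hMs ih =>
    intro Γ' ρ hw hρ
    obtain ⟨hΔ, hA'⟩ := hSg _ _ _ hc ρ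
    have hMs' := ih hw hρ
    rw [hΔ] at hMs'
    rw [Tm.ren_const, Tm.ren_instArgs, hMs.length_eq, hA']
    exact .cons hc hA hs hMs'
  | conv _ _ hs hAB ihM ihB =>
    intro Γ' ρ hw hρ
    have hB := ihB hw hρ
    rw [hs.ren] at hB
    exact .conv (ihM hw hρ) hB hs (hAB.ren ρ)
  | prod _ _ hs ihA ihB =>
    intro Γ' ρ hw hρ
    have hA := ihA hw hρ
    rw [Tm.ren_type] at hA
    have hB := ihB (.decl hA) (hρ.lift _)
    rw [hs.ren] at hB
    rw [hs.ren, Tm.ren_pi]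
    exact .prod hA hB hs
  | abs _ _ hs _ ihA ihB ihM =>
    intro Γ' ρ hw hρ
    have hA := ihA hw hρ
    rw [Tm.ren_type] at hA
    have hB := ihB (.decl hA) (hρ.lift _)
    rw [hs.ren] at hB
    rw [Tm.ren_lam, Tm.ren_pi]
    exact .abs hA hB hs (ihM (.decl hA) (hρ.lift _))
  | app _ _ ihM ihN =>
    intro Γ' ρ hw hρ
    have hM := ihM hw hρ
    rw [Tm.ren_pi] at hM
    rw [Tm.ren_app, Tm.ren_substAt_zero]
    exact .app hM (ihN hw hρ)
  | args_nil => exact .nil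
  | args_cons _ _ ihM ihMs =>
    rw [List.map_cons, Tm.renTele_cons]
    refine .cons (ihM ‹_› ‹_›) ?_
    rw [← Tm.renTele_instTele]
    exact ihMs ‹_› ‹_›

theorem Typed.weaken (hSg : SigClosed Sg) {Γ : List (Tm C)} {A M T : Tm C}
    (hA : Typed Sg R Γ A .type) (h : Typed Sg R Γ M T) :
    Typed Sg R (A :: Γ) (Tm.ren Nat.succ M) (Tm.ren Nat.succ T) :=
  h.ren hSg (.decl hA) (.succ A Γ)

/-- Every variable declared in `Γ` can be given the same type in `Γ'`. -/
def SubCtx (Sg : Sig C) (R : Rules C) (Γ Γ' : List (Tm C)) : Prop :=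
  ∀ n A, Γ[n]? = some A → Typed Sg R Γ' (.var n) (Tm.ren (· + (n + 1)) A)

theorem SubCtx.lift (hSg : SigClosed Sg) {Γ Γ' : List (Tm C)} (h : SubCtx Sg R Γ Γ') {A : Tm C}
    (hA : Typed Sg R Γ' A .type) : SubCtx Sg R (A :: Γ) (A :: Γ') := by
  rintro (_ | n) B hB
  · exact .var (.decl hA) (by simpa using hB)
  · have h' := hA.weaken hSg (h n B (by simpa using hB))
    rw [Tm.ren_ren, Tm.ren_var] at h'
    exact h'

theorem Typed.of_subCtx (hSg : SigClosed Sg) {Γ : List (Tm C)} {M T : Tm C}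
    (h : Typed Sg R Γ M T) :
    ∀ {Γ' : List (Tm C)}, Wf Sg R Γ' → SubCtx Sg R Γ Γ' → Typed Sg R Γ' M T := by
  induction h using Typed.induct
    (Q := fun Γ Ms Δ => ∀ {Γ' : List (Tm C)}, Wf Sg R Γ' →
      SubCtx Sg R Γ Γ' → TypedArgs Sg R Γ' Ms Δ) with
  | sort => exact fun hw _ => .sort hw
  | var _ hn => exact fun _ hΓ => hΓ _ _ hn
  | cons hc hA hs _ ih => exact fun hw hΓ => .cons hc hA hs (ih hw hΓ)
  | conv _ _ hs hAB ihM ihB => exact fun hw hΓ => .conv (ihM hw hΓ) (ihB hw hΓ) hs hAB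
  | prod _ _ hs ihA ihB =>
    intro Γ' hw hΓ
    have hA := ihA hw hΓ
    exact .prod hA (ihB (.decl hA) (hΓ.lift hSg hA)) hs
  | abs _ _ hs _ ihA ihB ihM =>
    intro Γ' hw hΓ
    have hA := ihA hw hΓ
    exact .abs hA (ihB (.decl hA) (hΓ.lift hSg hA)) hs (ihM (.decl hA) (hΓ.lift hSg hA))
  | app _ _ ihM ihN => exact fun hw hΓ => .app (ihM hw hΓ) (ihN hw hΓ)
  | args_nil => exact .nil
  | args_cons _ _ ihM ihMs => exact .cons (ihM ‹_› ‹_›) (ihMs ‹_› ‹_›)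

theorem Typed.conv_ctx (hSg : SigClosed Sg) {Γ : List (Tm C)} {A A' M T : Tm C}
    (hA : Typed Sg R Γ A .type) (hA' : Typed Sg R Γ A' .type) (hAA' : Conv R A' A)
    (h : Typed Sg R (A' :: Γ) M T) : Typed Sg R (A :: Γ) M T := by
  refine h.of_subCtx hSg (.decl hA) ?_
  rintro (_ | n) B hB
  · obtain rfl : A' = B := by simpa using hB
    have hw := hA.weaken hSg hA'
    rw [Tm.ren_type] at hw
    exact .conv (.var (.decl hA) rfl) hw (.inl rfl) (hAA'.symm.ren _)
  · exact .var (.decl hA) (by simpa using hB)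

theorem Typed.pi_inv {Γ : List (Tm C)} {A B T : Tm C} (h : Typed Sg R Γ (.pi A B) T) :
    Typed Sg R Γ A .type ∧ ∃ s, IsDKSort s ∧ Typed Sg R (A :: Γ) B s := by
  generalize hM : Tm.pi A B = M at h
  induction h using Typed.induct (Q := fun _ _ _ => True) with
  | conv _ _ _ _ ih => exact ih hM
  | prod hA hB hs =>
    cases hM
    exact ⟨hA, _, hs, hB⟩
  | sort | var | cons | abs | app => cases hM
  | _ => trivial

theorem Typed.lam_inv {Γ : List (Tm C)} {A M T : Tm C} (h : Typed Sg R Γ (.lam A M) T) :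
    ∃ B, Typed Sg R Γ A .type ∧ Typed Sg R (A :: Γ) M B ∧ Conv R (.pi A B) T ∧
      ∃ s, Typed Sg R Γ T s := by
  generalize hM : Tm.lam A M = M' at h
  induction h using Typed.induct (Q := fun _ _ _ => True) with
  | conv _ hB _ hAB ih =>
    obtain ⟨B', hA, hM', hc, -⟩ := ih hM
    exact ⟨B', hA, hM', hc.trans hAB, _, hB⟩
  | abs hA hB hs hM' =>
    cases hM
    exact ⟨_, hA, hM', .refl _, _, .prod hA hB hs⟩
  | sort | var | cons | prod | app => cases hM
  | _ => trivial

end Weakening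

theorem sigClosed_sigEPTS (Ar : S → S → Prop) (Rr : S → S → S → Prop) :
    SigClosed (sigEPTS Ar Rr) := by
  intro c Δ A h ρ
  cases h <;> simp [Tm.renTele, Ucon, Elcon, ProdC, Tm.liftRen]

/-! ## Confluence of the rewrite system of the encoding -/

section Confluence
variable {Ar : S → S → Prop} {Rr : S → S → S → Prop}

mutual
/-- Parallel reduction for `β` and `rulesEPTS Ar Rr`. -/
inductive Par (Ar : S → S → Prop) (Rr : S → S → S → Prop) :
    Tm (EConst S) → Tm (EConst S) → Prop
  | var (n) : Par Ar Rr (.var n) (.var n)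
  | type : Par Ar Rr .type .type
  | kind : Par Ar Rr .kind .kind
  | const {c Ms Ns} : ParList Ar Rr Ms Ns → Par Ar Rr (.const c Ms) (.const c Ns)
  | app {M M' N N'} : Par Ar Rr M M' → Par Ar Rr N N' → Par Ar Rr (.app M N) (.app M' N')
  | lam {A A' M M'} : Par Ar Rr A A' → Par Ar Rr M M' → Par Ar Rr (.lam A M) (.lam A' M')
  | pi {A A' B B'} : Par Ar Rr A A' → Par Ar Rr B B' → Par Ar Rr (.pi A B) (.pi A' B')
  | beta {A M M' N N'} : Par Ar Rr M M' → Par Ar Rr N N' →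
      Par Ar Rr (.app (.lam A M) N) (Tm.substAt 0 N' M')
  | u_red {s₁ s₂} : Ar s₁ s₂ → Par Ar Rr (Elcon s₂ (ucon s₁)) (Ucon s₁)
  | app_abs {s₁ s₂ s₃ A B A' B' M M₁ N N₁} : Rr s₁ s₂ s₃ → Par Ar Rr M M₁ → Par Ar Rr N N₁ →
      Par Ar Rr (appC s₁ s₂ A B (absC s₁ s₂ A' B' M) N) (.app M₁ N₁)

/-- Parallel reduction of lists of arguments. -/
inductive ParList (Ar : S → S → Prop) (Rr : S → S → S → Prop) :
    List (Tm (EConst S)) → List (Tm (EConst S)) → Prop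
  | nil : ParList Ar Rr [] []
  | cons {M N Ms Ns} : Par Ar Rr M N → ParList Ar Rr Ms Ns → ParList Ar Rr (M :: Ms) (N :: Ns)
end

theorem ParList.of_forall_mem {Ms : List (Tm (EConst S))} {f g : Tm (EConst S) → Tm (EConst S)}
    (h : ∀ M ∈ Ms, Par Ar Rr (f M) (g M)) : ParList Ar Rr (Ms.map f) (Ms.map g) := by
  induction Ms with
  | nil => exact .nil
  | cons M Ms ih =>
    rw [List.forall_mem_cons] at h
    exact .cons h.1 (ih h.2)

theorem Par.refl (M : Tm (EConst S)) : Par Ar Rr M M := by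
  induction M using Tm.induct with
  | var n => exact .var n
  | const c Ms ih => simpa using Par.const (c := c) (ParList.of_forall_mem (f := id) (g := id) ih)
  | type => exact .type
  | kind => exact .kind
  | app _ _ h h' => exact .app h h'
  | lam _ _ h h' => exact .lam h h'
  | pi _ _ h h' => exact .pi h h'

theorem ParList.refl (Ms : List (Tm (EConst S))) : ParList Ar Rr Ms Ms := by
  simpa using ParList.of_forall_mem (f := id) (g := id) fun M (_ : M ∈ Ms) => Par.refl M

theorem ParList.append_cons {M N : Tm (EConst S)} (h : Par Ar Rr M N)
    (l₁ l₂ : List (Tm (EConst S))) : ParList Ar Rr (l₁ ++ M :: l₂) (l₁ ++ N :: l₂) := by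
  induction l₁ with
  | nil => exact .cons h (.refl _)
  | cons P l₁ ih => exact .cons (.refl P) ih

theorem Par.of_step {M N : Tm (EConst S)} (h : Step (rulesEPTS Ar Rr) M N) : Par Ar Rr M N := by
  induction h with
  | base h =>
    rcases h with ⟨A, P, Q, rfl, rfl⟩ | ⟨rl, hrl, σ, rfl, rfl⟩
    · exact .beta (.refl P) (.refl Q)
    · rcases hrl with hrl | hrl <;> obtain ⟨h⟩ := hrl
      · simpa [Elcon, ucon, Ucon] using Par.u_red h
      · simpa [appC, absC] using Par.app_abs h (.refl _) (.refl _)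
  | appL _ ih => exact .app ih (.refl _)
  | appR _ ih => exact .app (.refl _) ih
  | lamA _ ih => exact .lam ih (.refl _)
  | lamM _ ih => exact .lam (.refl _) ih
  | piA _ ih => exact .pi ih (.refl _)
  | piB _ ih => exact .pi (.refl _) ih
  | constArg _ ih => exact .const (.append_cons ih _ _)

theorem Conv.beta {R : Rules C} (A M N : Tm C) :
    Conv R (.app (.lam A M) N) (Tm.substAt 0 N M) :=
  .rel _ _ (.base (.inl ⟨A, M, N, rfl, rfl⟩))

theorem Conv.u_red {s₁ s₂ : S} (h : Ar s₁ s₂) :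
    Conv (rulesEPTS Ar Rr) (Elcon s₂ (ucon s₁)) (Ucon s₁) :=
  .rel _ _ (.base (.inr ⟨_, .inl (.u_red h), Tm.var, by simp [Elcon, ucon], by simp [Ucon]⟩))

theorem Conv.app_abs {s₁ s₂ s₃ : S} (h : Rr s₁ s₂ s₃) (A B A' B' M N : Tm (EConst S)) :
    Conv (rulesEPTS Ar Rr) (appC s₁ s₂ A B (absC s₁ s₂ A' B' M) N) (.app M N) :=
  .rel _ _ (.base (.inr ⟨_, .inr (.beta h), fun n => [A, B, A', B', M, N].getD n .type,
    by simp [appC, absC], by simp⟩))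

theorem Par.conv {M N : Tm (EConst S)} (h : Par Ar Rr M N) : Conv (rulesEPTS Ar Rr) M N := by
  induction h using Par.rec
    (motive_2 := fun Ms Ns _ => ∀ c l,
      Conv (rulesEPTS Ar Rr) (.const c (l ++ Ms)) (.const c (l ++ Ns))) with
  | var | type | kind => exact .refl _
  | const _ ih => exact ih _ []
  | app _ _ ih ih' => exact ih.app ih'
  | lam _ _ ih ih' => exact ih.lam ih'
  | pi _ _ ih ih' => exact ih.pi ih'
  | beta _ _ ih ih' => exact (((Conv.refl _).lam ih).app ih').trans (.beta _ _ _)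
  | u_red h => exact .u_red h
  | app_abs h _ _ ih ih' => exact (Conv.app_abs h _ _ _ _ _ _).trans (ih.app ih')
  | nil => exact .refl _
  | cons _ _ ih ih' => exact ih.const_cons (ih' _)

theorem Par.ren {M N : Tm (EConst S)} (h : Par Ar Rr M N) :
    ∀ ρ : Nat → Nat, Par Ar Rr (Tm.ren ρ M) (Tm.ren ρ N) := by
  induction h using Par.rec
    (motive_2 := fun Ms Ns _ => ∀ ρ : Nat → Nat,
      ParList Ar Rr (Ms.map (Tm.ren ρ)) (Ns.map (Tm.ren ρ))) with
  | var | type | kind => exact fun _ => .refl _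
  | const _ ih => intro ρ; simpa using .const (ih ρ)
  | app _ _ ih ih' => intro ρ; simpa using .app (ih ρ) (ih' ρ)
  | lam _ _ ih ih' => intro ρ; simpa using .lam (ih ρ) (ih' _)
  | pi _ _ ih ih' => intro ρ; simpa using .pi (ih ρ) (ih' _)
  | beta _ _ ih ih' =>
    intro ρ
    rw [Tm.ren_app, Tm.ren_lam, Tm.ren_substAt_zero]
    exact .beta (ih _) (ih' ρ)
  | u_red h => intro ρ; simpa [Elcon, ucon, Ucon] using Par.u_red h
  | app_abs h _ _ ih ih' =>
    intro ρ
    simpa [appC, absC] using Par.app_abs h (ih ρ) (ih' ρ)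
  | nil => exact .nil
  | cons _ _ ih ih' => exact .cons (ih _) (ih' _)

theorem Par.liftSub {σ τ : Nat → Tm (EConst S)} (h : ∀ n, Par Ar Rr (σ n) (τ n)) :
    ∀ n, Par Ar Rr (Tm.liftSub σ n) (Tm.liftSub τ n)
  | 0 => .refl _
  | n + 1 => (h n).ren _

theorem Par.sub {M N : Tm (EConst S)} (h : Par Ar Rr M N) :
    ∀ {σ τ : Nat → Tm (EConst S)}, (∀ n, Par Ar Rr (σ n) (τ n)) →
      Par Ar Rr (Tm.sub σ M) (Tm.sub τ N) := by
  induction h using Par.rec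
    (motive_2 := fun Ms Ns _ => ∀ {σ τ : Nat → Tm (EConst S)},
      (∀ n, Par Ar Rr (σ n) (τ n)) →
        ParList Ar Rr (Ms.map (Tm.sub σ)) (Ns.map (Tm.sub τ))) with
  | var n => intro σ τ hσ; simpa using hσ n
  | type | kind => intro σ τ _; simpa using .refl _
  | const _ ih => intro σ τ hσ; simpa using .const (ih hσ)
  | app _ _ ih ih' => intro σ τ hσ; simpa using .app (ih hσ) (ih' hσ)
  | lam _ _ ih ih' => intro σ τ hσ; simpa using .lam (ih hσ) (ih' (Par.liftSub hσ))
  | pi _ _ ih ih' => intro σ τ hσ; simpa using .pi (ih hσ) (ih' (Par.liftSub hσ))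
  | beta _ _ ih ih' =>
    intro σ τ hσ
    rw [Tm.sub_app, Tm.sub_lam, Tm.sub_substAt_zero]
    exact .beta (ih (Par.liftSub hσ)) (ih' hσ)
  | u_red h => intro σ τ _; simpa [Elcon, ucon, Ucon] using Par.u_red h
  | app_abs h _ _ ih ih' =>
    intro σ τ hσ
    simpa [appC, absC] using Par.app_abs h (ih hσ) (ih' hσ)
  | nil => exact .nil
  | cons _ _ ih ih' => exact .cons (ih ‹_›) (ih' ‹_›)

theorem Par.substAt_zero {M M' N N' : Tm (EConst S)} (hM : Par Ar Rr M M')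
    (hN : Par Ar Rr N N') : Par Ar Rr (Tm.substAt 0 N M) (Tm.substAt 0 N' M') := by
  refine hM.sub fun n => ?_
  cases n with
  | zero => simpa using hN.ren _
  | succ n => simpa using .refl _

theorem Par.lam_inv {A M N : Tm (EConst S)} (h : Par Ar Rr (.lam A M) N) :
    ∃ A' M', N = .lam A' M' ∧ Par Ar Rr A A' ∧ Par Ar Rr M M' := by
  cases h with | lam hA hM => exact ⟨_, _, rfl, hA, hM⟩

theorem Par.abs_inv {s₁ s₂ : S} {A B M N : Tm (EConst S)}
    (h : Par Ar Rr (absC s₁ s₂ A B M) N) :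
    ∃ A' B' M', N = absC s₁ s₂ A' B' M' ∧ Par Ar Rr M M' := by
  cases h with
  | const h =>
    obtain _ | ⟨_, _ | ⟨_, _ | ⟨hM, _ | _⟩⟩⟩ := h
    exact ⟨_, _, _, rfl, hM⟩

theorem ParList.exists_development {Ms : List (Tm (EConst S))}
    (h : ∀ M ∈ Ms, ∃ D, ∀ N, Par Ar Rr M N → Par Ar Rr N D) :
    ∃ Ds, ∀ Ns, ParList Ar Rr Ms Ns → ParList Ar Rr Ns Ds := by
  induction Ms with
  | nil => exact ⟨[], fun Ns h => by cases h; exact .nil⟩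
  | cons M Ms ih =>
    rw [List.forall_mem_cons] at h
    obtain ⟨⟨D, hD⟩, hs⟩ := h
    obtain ⟨Ds, hDs⟩ := ih hs
    refine ⟨D :: Ds, fun Ns h => ?_⟩
    cases h with | cons h hs => exact .cons (hD _ h) (hDs _ hs)

/-- Every term has a complete development, to which all its parallel reducts reduce. -/
theorem Par.exists_development (M : Tm (EConst S)) :
    ∃ D, ∀ N, Par Ar Rr M N → Par Ar Rr N D := by
  induction M using Tm.induct with
  | var n => exact ⟨_, fun N h => by cases h; exact .var n⟩
  | type => exact ⟨_, fun N h => by cases h; exact .type⟩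
  | kind => exact ⟨_, fun N h => by cases h; exact .kind⟩
  | lam A M hA hM =>
    obtain ⟨D, hD⟩ := hA
    obtain ⟨E, hE⟩ := hM
    exact ⟨.lam D E, fun N h => by cases h with | lam h h' => exact .lam (hD _ h) (hE _ h')⟩
  | pi A B hA hB =>
    obtain ⟨D, hD⟩ := hA
    obtain ⟨E, hE⟩ := hB
    exact ⟨.pi D E, fun N h => by cases h with | pi h h' => exact .pi (hD _ h) (hE _ h')⟩
  | app M N hM hN =>
    obtain ⟨D, hD⟩ := hM
    obtain ⟨E, hE⟩ := hN
    by_cases hlam : ∃ A P, M = .lam A P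
    · obtain ⟨A, P, rfl⟩ := hlam
      obtain ⟨A', P', rfl, -, -⟩ := (hD _ (.refl _)).lam_inv
      refine ⟨Tm.substAt 0 E P', fun Q h => ?_⟩
      cases h with
      | app h h' =>
        obtain ⟨A₁, P₁, rfl, -, -⟩ := h.lam_inv
        cases hD _ h with | lam _ hP => exact .beta hP (hE _ h')
      | beta h h' =>
        cases hD _ (.lam (.refl A) h) with | lam _ hP => exact hP.substAt_zero (hE _ h')
    · refine ⟨.app D E, fun Q h => ?_⟩
      cases h with
      | app h h' => exact .app (hD _ h) (hE _ h')
      | beta => exact absurd ⟨_, _, rfl⟩ hlam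
  | const c Ms ih =>
    by_cases hu : ∃ s₁ s₂, Ar s₁ s₂ ∧ Tm.const c Ms = Elcon s₂ (ucon s₁)
    · obtain ⟨s₁, s₂, hA, h⟩ := hu
      cases h
      refine ⟨Ucon s₁, fun N h => ?_⟩
      cases h with
      | const h =>
        obtain _ | ⟨h, _ | _⟩ := h
        cases h with
        | const h =>
          cases h
          exact .u_red hA
      | u_red => exact .refl _
    by_cases happ : ∃ s₁ s₂ s₃ A B A' B' M N, Rr s₁ s₂ s₃ ∧
        Tm.const c Ms = appC s₁ s₂ A B (absC s₁ s₂ A' B' M) N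
    · obtain ⟨s₁, s₂, s₃, A, B, A', B', M, N, hR, h⟩ := happ
      cases h
      obtain ⟨D, hD⟩ := ih (absC s₁ s₂ A' B' M) (by simp)
      obtain ⟨E, hE⟩ := ih N (by simp)
      obtain ⟨A₁, B₁, M₁, rfl, -⟩ := (hD _ (.refl _)).abs_inv
      refine ⟨.app M₁ E, fun Q h => ?_⟩
      cases h with
      | const h =>
        obtain _ | ⟨_, _ | ⟨_, _ | ⟨h, _ | ⟨h', _ | _⟩⟩⟩⟩ := h
        obtain ⟨A₂, B₂, M₂, rfl, -⟩ := h.abs_inv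
        obtain ⟨_, _, _, e, hM⟩ := (hD _ h).abs_inv
        cases e
        exact .app_abs hR hM (hE _ h')
      | app_abs _ h h' =>
        have h₁ : Par Ar Rr (absC s₁ s₂ A' B' M) (absC s₁ s₂ A' B' _) :=
          .const (.append_cons h [A', B'] [])
        obtain ⟨_, _, _, e, hM⟩ := (hD _ h₁).abs_inv
        cases e
        exact .app hM (hE _ h')
    · obtain ⟨Ds, hDs⟩ := ParList.exists_development ih
      refine ⟨.const c Ds, fun N h => ?_⟩
      cases h with
      | const h => exact .const (hDs _ h)
      | u_red h => exact absurd ⟨_, _, h, rfl⟩ hu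
      | app_abs h => exact absurd ⟨_, _, _, _, _, _, _, _, _, h, rfl⟩ happ

/-- The Church–Rosser property. -/
theorem Conv.join_par {M N : Tm (EConst S)} (h : Conv (rulesEPTS Ar Rr) M N) :
    Relation.Join (Relation.ReflTransGen (Par Ar Rr)) M N := by
  have hequiv : Equivalence (Relation.Join (Relation.ReflTransGen (Par Ar Rr))) :=
    Relation.equivalence_join_reflTransGen fun a b c hab hac => by
      obtain ⟨D, hD⟩ := Par.exists_development (Ar := Ar) (Rr := Rr) a
      exact ⟨D, .single (hD _ hab), .single (hD _ hac)⟩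
  induction h with
  | rel _ _ h => exact ⟨_, .single (.of_step h), .refl⟩
  | refl => exact hequiv.refl _
  | symm _ _ _ ih => exact hequiv.symm ih
  | trans _ _ _ _ _ ih ih' => exact hequiv.trans ih ih'

theorem pi_of_reflTransGen_par {A B N : Tm (EConst S)}
    (h : Relation.ReflTransGen (Par Ar Rr) (.pi A B) N) :
    ∃ A' B', N = .pi A' B' ∧ Conv (rulesEPTS Ar Rr) A A' ∧ Conv (rulesEPTS Ar Rr) B B' := by
  induction h with
  | refl => exact ⟨A, B, rfl, .refl _, .refl _⟩
  | tail _ h ih =>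
    obtain ⟨A', B', rfl, hA, hB⟩ := ih
    cases h with | pi h h' => exact ⟨_, _, rfl, hA.trans h.conv, hB.trans h'.conv⟩

theorem Conv.pi_inj {A B A' B' : Tm (EConst S)}
    (h : Conv (rulesEPTS Ar Rr) (.pi A B) (.pi A' B')) :
    Conv (rulesEPTS Ar Rr) A A' ∧ Conv (rulesEPTS Ar Rr) B B' := by
  obtain ⟨D, h₁, h₂⟩ := h.join_par
  obtain ⟨A₁, B₁, rfl, hA₁, hB₁⟩ := pi_of_reflTransGen_par h₁
  obtain ⟨A₂, B₂, e, hA₂, hB₂⟩ := pi_of_reflTransGen_par h₂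
  cases e
  exact ⟨hA₁.trans hA₂.symm, hB₁.trans hB₂.symm⟩

/-- Sorts of Dedukti and terms headed by `U` or `El`, which never reduce to a product. -/
inductive AtomicType : Tm (EConst S) → Prop
  | type : AtomicType .type
  | kind : AtomicType .kind
  | U (s Ms) : AtomicType (.const (.U s) Ms)
  | El (s Ms) : AtomicType (.const (.El s) Ms)

theorem IsDKSort.atomicType {s : Tm (EConst S)} (h : IsDKSort s) : AtomicType s := by
  rcases h with rfl | rfl
  · exact .type
  · exact .kind

theorem AtomicType.par {M N : Tm (EConst S)} (hM : AtomicType M) (h : Par Ar Rr M N) :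
    AtomicType N := by
  cases hM <;> cases h <;> constructor

theorem AtomicType.not_conv_pi {T A B : Tm (EConst S)} (hT : AtomicType T) :
    ¬ Conv (rulesEPTS Ar Rr) T (.pi A B) := by
  intro h
  obtain ⟨D, h₁, h₂⟩ := h.join_par
  have hD : AtomicType D := by
    clear h₂
    induction h₁ with
    | refl => exact hT
    | tail _ h ih => exact ih.par h
  obtain ⟨A', B', rfl, -, -⟩ := pi_of_reflTransGen_par h₂
  cases hD

end Confluence

theorem TransCtx.atomicType {Ar : S → S → Prop} {Rr : S → S → S → Prop} {Γ : List (ETm S)}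
    {Δ : List (Tm (EConst S))} (h : TransCtx Ar Rr Γ Δ) :
    ∀ A ∈ Δ, AtomicType A := by
  induction h with
  | nil => simp
  | cons _ _ ih => exact List.forall_mem_cons.2 ⟨.El _ _, ih⟩

theorem AtomicType.sub {A : Tm (EConst S)} (h : AtomicType A) (σ : Nat → Tm (EConst S)) :
    AtomicType (Tm.sub σ A) := by
  cases h <;> simp <;> constructor

theorem atomicType_of_mem_sigEPTS {Ar : S → S → Prop} {Rr : S → S → S → Prop} {c : EConst S}
    {Δ : List (Tm (EConst S))} {A : Tm (EConst S)} (h : (c, Δ, A) ∈ sigEPTS Ar Rr) :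
    AtomicType A := by
  cases h <;> constructor

theorem BetaNormal.exists_lam_of_typed {Ar : S → S → Prop} {Rr : S → S → S → Prop}
    {Γ : List (Tm (EConst S))} {M T : Tm (EConst S)}
    (h : Typed (sigEPTS Ar Rr) (rulesEPTS Ar Rr) Γ M T) (hΓ : ∀ A ∈ Γ, AtomicType A)
    (hM : BetaNormal M) {A B : Tm (EConst S)} (hT : Conv (rulesEPTS Ar Rr) T (.pi A B)) :
    ∃ A' N, M = .lam A' N := by
  induction h using Typed.induct (Q := fun _ _ _ => True) generalizing A B with
  | sort => exact absurd hT AtomicType.kind.not_conv_pi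
  | var _ hn =>
    rw [Tm.ren_eq_sub] at hT
    exact absurd hT ((hΓ _ (List.mem_of_getElem? hn)).sub _).not_conv_pi
  | cons hc => exact absurd hT ((atomicType_of_mem_sigEPTS hc).sub _).not_conv_pi
  | conv _ _ _ hAB ih => exact ih hΓ hM (hAB.trans hT)
  | prod _ _ hs => exact absurd hT hs.atomicType.not_conv_pi
  | abs => exact ⟨_, _, rfl⟩
  | app _ _ ih =>
    obtain ⟨A', N, rfl⟩ := ih hΓ (fun N h => hM _ (.appL h)) (.refl _)
    exact absurd (.base ⟨_, _, _, rfl, rfl⟩) (hM _)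
  | _ => trivial

/-- Every β-normal term of product type over a translated context is
an abstraction. -/
theorem beta_normal_of_pi_type_is_abstraction {S : Type} (Ar : S → S → Prop)
    (Rr : S → S → S → Prop) (hfun : FunctionalSpec Ar Rr)
    {Γ : List (ETm S)} {Δ : List (Tm (EConst S))} (hΓ : TransCtx Ar Rr Γ Δ)
    {M A B : Tm (EConst S)} (hnf : BetaNormal M)
    (h : Typed (sigEPTS Ar Rr) (rulesEPTS Ar Rr) Δ M (Tm.pi A B)) :
    ∃ A' N, M = Tm.lam A' N ∧ Conv (rulesEPTS Ar Rr) A' A ∧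
      Typed (sigEPTS Ar Rr) (rulesEPTS Ar Rr) (A :: Δ) N B := by
  obtain ⟨A', N, rfl⟩ := BetaNormal.exists_lam_of_typed h hΓ.atomicType hnf (.refl _)
  obtain ⟨B', hA', hN, hpi, s, hs⟩ := h.lam_inv
  obtain ⟨hA, s', hs', hB⟩ := hs.pi_inv
  obtain ⟨hAA', hBB'⟩ := hpi.pi_inj
  exact ⟨A', N, rfl, hAA',
    .conv (hA.conv_ctx (sigClosed_sigEPTS Ar Rr) hA' hAA' hN) hB hs' hBB'⟩

end DKPaper
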